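/- arXiv:2008.01335 — 2 statements merged into one kernel-verified Lean document; each statement's English description precedes it below -/
import Mathlib

section
/- Let q ≥ 2 be an even integer, let g be a real polynomial of odd degree q − 1 with negative leading coefficient, and let h : ℝ → ℝ be Lipschitz continuous. Then f := g + h satisfies the dissipativity condition: there exist constants L_f ∈ ℝ and θ > 0 such that (f(ξ) − f(η))(ξ − η) ≤ L_f|ξ − η|² − θ|ξ − η|^q for all ξ, η ∈ ℝ. -/
open Filter in
theorem Polynomial.exists_forall_eval_le_of_even {p : Polynomial ℝ} {n : ℕ} (hn : Even n)
    (hdeg : p.natDegree ≤ n) (hcoeff : p.coeff n < 0) : ∃ M : ℝ, ∀ x, p.eval x ≤ M := by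
  have hnat : p.natDegree = n :=
    Polynomial.natDegree_eq_of_le_of_coeff_ne_zero hdeg hcoeff.ne
  have hlead : p.leadingCoeff < 0 := by rwa [Polynomial.leadingCoeff, hnat]
  rcases Nat.eq_zero_or_pos n with rfl | hpos
  · rw [Polynomial.eq_C_of_natDegree_eq_zero hnat]
    exact ⟨p.coeff 0, fun x => by simp⟩
  have htop : Tendsto (fun x => p.eval x) atTop atBot :=
    p.tendsto_atBot_of_leadingCoeff_nonpos
      (Polynomial.natDegree_pos_iff_degree_pos.1 (hnat ▸ hpos)) hlead.le
  have hbot : Tendsto (fun x => p.eval x) atBot atBot := by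
    have hneg : Tendsto (fun x => (p.comp (-Polynomial.X)).eval x) atTop atBot := by
      refine Polynomial.tendsto_atBot_of_leadingCoeff_nonpos _ ?_ ?_
      · apply Polynomial.natDegree_pos_iff_degree_pos.1
        simpa [Polynomial.natDegree_comp, hnat] using hpos
      · rw [Polynomial.comp_neg_X_leadingCoeff_eq, hnat, hn.neg_one_pow, one_mul]
        exact hlead.le
    simpa [Function.comp_def] using hneg.comp tendsto_neg_atBot_atTop
  obtain ⟨x, hx⟩ := p.continuous.exists_forall_ge
    (by rw [cocompact_eq_atBot_atTop]; exact hbot.sup htop)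
  exact ⟨p.eval x, hx⟩

theorem Polynomial.eval_sub_mul_sub_le_of_derivative_le {p : Polynomial ℝ} {M : ℝ}
    (hM : ∀ x, p.derivative.eval x ≤ M) (x y : ℝ) :
    (p.eval x - p.eval y) * (x - y) ≤ M * (x - y) ^ 2 := by
  have hanti : Antitone fun x => (p - C M * X).eval x := by
    refine antitone_of_deriv_nonpos (Polynomial.differentiable _) fun x => ?_
    rw [Polynomial.deriv]
    simpa using hM x
  rcases le_total x y with hxy | hxy
  · have := hanti hxy
    simp only [eval_sub, eval_mul, eval_C, eval_X] at this
    nlinarith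
  · have := hanti hxy
    simp only [eval_sub, eval_mul, eval_C, eval_X] at this
    nlinarith

theorem Odd.add_mul_pow_add_pow_nonneg {n : ℕ} (hn : Odd n) (x y : ℝ) :
    0 ≤ (x + y) * (x ^ n + y ^ n) := by
  rcases le_total (-y) x with hxy | hxy
  · have := hn.strictMono_pow.monotone hxy
    simp only [hn.neg_pow] at this
    exact mul_nonneg (by linarith) (by linarith)
  · have := hn.strictMono_pow.monotone hxy
    simp only [hn.neg_pow] at this
    exact mul_nonneg_of_nonpos_of_nonpos (by linarith) (by linarith)

theorem sub_pow_le_pow_sub_pow_mul_sub (k : ℕ) (x y : ℝ) :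
    (1 / 4) ^ k * (x - y) ^ (2 * k + 2) ≤ (x ^ (2 * k + 1) - y ^ (2 * k + 1)) * (x - y) := by
  induction k with
  | zero => simp [sq]
  | succ k ih =>
    have hodd := (odd_two_mul_add_one k).add_mul_pow_add_pow_nonneg x y
    have hpow : 0 ≤ (1 / 4 : ℝ) ^ k * (x - y) ^ (2 * k + 2) :=
      mul_nonneg (by positivity) (Even.pow_nonneg ⟨k + 1, by ring⟩ _)
    calc (1 / 4) ^ (k + 1) * (x - y) ^ (2 * (k + 1) + 2)
        = (x - y) ^ 2 / 4 * ((1 / 4) ^ k * (x - y) ^ (2 * k + 2)) := by ring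
      _ ≤ (x ^ 2 + y ^ 2) / 2 * ((1 / 4) ^ k * (x - y) ^ (2 * k + 2)) :=
          mul_le_mul_of_nonneg_right (by nlinarith [sq_nonneg (x + y)]) hpow
      _ ≤ (x ^ 2 + y ^ 2) / 2 * ((x ^ (2 * k + 1) - y ^ (2 * k + 1)) * (x - y)) :=
          mul_le_mul_of_nonneg_left ih (by positivity)
      _ ≤ (x ^ 2 + y ^ 2) / 2 * ((x ^ (2 * k + 1) - y ^ (2 * k + 1)) * (x - y))
            + (x - y) ^ 2 / 2 * ((x + y) * (x ^ (2 * k + 1) + y ^ (2 * k + 1))) :=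
          le_add_of_nonneg_right (mul_nonneg (by positivity) hodd)
      _ = (x ^ (2 * (k + 1) + 1) - y ^ (2 * (k + 1) + 1)) * (x - y) := by ring

theorem LipschitzWith.sub_mul_sub_le {h : ℝ → ℝ} {K : NNReal} (hh : LipschitzWith K h)
    (x y : ℝ) : (h x - h y) * (x - y) ≤ K * (x - y) ^ 2 :=
  calc (h x - h y) * (x - y) ≤ |h x - h y| * |x - y| := by
        rw [← abs_mul]; exact le_abs_self _
    _ ≤ K * |x - y| * |x - y| := by
        gcongr
        simpa [Real.dist_eq] using hh.dist_le_mul x y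
    _ = K * (x - y) ^ 2 := by rw [mul_assoc, abs_mul_abs_self, sq]

/-- A polynomial of odd degree `q - 1` (with `q ≥ 2` even) with negative leading
coefficient, perturbed by a Lipschitz function, satisfies the dissipativity condition
`(f ξ - f η)(ξ - η) ≤ L_f |ξ - η|² - θ |ξ - η|^q`. -/
theorem statement0 (q : ℕ) (hq : 2 ≤ q) (hq_even : Even q)
    (g : Polynomial ℝ) (hdeg : g.natDegree = q - 1) (hlead : g.leadingCoeff < 0)
    (h : ℝ → ℝ) (K : NNReal) (hh : LipschitzWith K h)
    (f : ℝ → ℝ) (hf : ∀ ξ : ℝ, f ξ = g.eval ξ + h ξ) :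
    ∃ (L_f : ℝ) (θ : ℝ), 0 < θ ∧
      ∀ ξ η : ℝ, (f ξ - f η) * (ξ - η) ≤ L_f * |ξ - η| ^ 2 - θ * |ξ - η| ^ q := by
  obtain ⟨k, rfl⟩ : ∃ k, q = 2 * k + 2 := by
    obtain ⟨m, rfl⟩ := hq_even
    exact ⟨m - 1, by omega⟩
  rw [show 2 * k + 2 - 1 = 2 * k + 1 by omega] at hdeg
  have hcoeff : g.coeff (2 * k + 1) < 0 := by rwa [← hdeg]
  set c : ℝ := -g.coeff (2 * k + 1) / 2 with hc
  have hcpos : 0 < c := by linarith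
  set p : Polynomial ℝ := g + Polynomial.C c * Polynomial.X ^ (2 * k + 1) with hp
  have hpdeg : p.natDegree ≤ 2 * k + 1 :=
    Polynomial.natDegree_add_le_of_degree_le hdeg.le (Polynomial.natDegree_C_mul_X_pow_le _ _)
  obtain ⟨M, hM⟩ := Polynomial.exists_forall_eval_le_of_even (p := p.derivative)
    (even_two_mul k) ((Polynomial.natDegree_derivative_le p).trans (by omega)) (by
      rw [Polynomial.coeff_derivative]
      refine mul_neg_of_neg_of_pos ?_ (by positivity)
      rw [hp, Polynomial.coeff_add, Polynomial.coeff_C_mul, Polynomial.coeff_X_pow_self]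
      linarith)
  refine ⟨M + K, c * (1 / 4) ^ k, by positivity, fun ξ η => ?_⟩
  have hpoly := Polynomial.eval_sub_mul_sub_le_of_derivative_le hM ξ η
  simp only [hp, Polynomial.eval_add, Polynomial.eval_mul, Polynomial.eval_C,
    Polynomial.eval_pow, Polynomial.eval_X] at hpoly
  have hpow := mul_le_mul_of_nonneg_left (sub_pow_le_pow_sub_pow_mul_sub k ξ η) hcpos.le
  have hlip := hh.sub_mul_sub_le ξ η
  rw [sq_abs, Even.pow_abs hq_even, hf, hf]
  linarith
end

section
/- For T > 0 and λ ∈ ℝ, define γ_t := ∫_0^{T−t} e^{2λr} dr for t ∈ [0, T]. Let 0 < s < T and let u : [0, s] → [0, ∞) be differentiable with u'(t) ≤ −2λ u(t) − 2 u(t)/γ_t for all t ∈ [0, s]. Then u(s)/γ_s + ∫_0^s u(t)/γ_t² dt ≤ u(0)/γ_0. -/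
open MeasureTheory intervalIntegral

theorem mul_integral_exp_mul (c x : ℝ) :
    c * ∫ r in (0 : ℝ)..x, Real.exp (c * r) = Real.exp (c * x) - 1 := by
  rw [← intervalIntegral.integral_const_mul, integral_eq_sub_of_hasDerivAt
    (f := fun r => Real.exp (c * r))]
  · simp
  · intro r _
    simpa [mul_comm] using ((hasDerivAt_id r).const_mul c).exp
  · exact Continuous.intervalIntegrable (by fun_prop) _ _

theorem hasDerivAt_integral_exp_mul_sub (c T t : ℝ) :
    HasDerivAt (fun t => ∫ r in (0 : ℝ)..(T - t), Real.exp (c * r))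
      (-(c * (∫ r in (0 : ℝ)..(T - t), Real.exp (c * r)) + 1)) t := by
  have hcont : Continuous fun r : ℝ => Real.exp (c * r) := by fun_prop
  have h := (hcont.integral_hasStrictDerivAt 0 (T - t)).hasDerivAt.comp t
    ((hasDerivAt_id t).const_sub T)
  rw [mul_integral_exp_mul]
  simpa [Function.comp_def] using h

/-- Pathwise comparison estimate for the coupling: if `u : [0, s] → [0, ∞)` is
differentiable with `u' t ≤ -2λ u t - 2 u t / γ t`, where
`γ_t := ∫_0^{T-t} e^{2λr} dr` and `0 < s < T`, then
`u s / γ s + ∫_0^s u t / γ t ^ 2 dt ≤ u 0 / γ 0`. -/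
theorem statement10 (T : ℝ) (hT : 0 < T) (lam : ℝ)
    (γ : ℝ → ℝ) (hγ : ∀ t : ℝ, γ t = ∫ r in (0 : ℝ)..(T - t), Real.exp (2 * lam * r))
    (s : ℝ) (hs0 : 0 < s) (hsT : s < T)
    (u u' : ℝ → ℝ)
    (hu_nonneg : ∀ t ∈ Set.Icc (0 : ℝ) s, 0 ≤ u t)
    (hu_deriv : ∀ t ∈ Set.Icc (0 : ℝ) s, HasDerivAt u (u' t) t)
    (hu_ineq : ∀ t ∈ Set.Icc (0 : ℝ) s, u' t ≤ -(2 * lam) * u t - 2 * u t / γ t) :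
    u s / γ s + (∫ t in (0 : ℝ)..s, u t / γ t ^ 2) ≤ u 0 / γ 0 := by
  have hγ_deriv (t : ℝ) : HasDerivAt γ (-(2 * lam * γ t + 1)) t := by
    rw [hγ t, funext hγ]
    exact hasDerivAt_integral_exp_mul_sub (2 * lam) T t
  have hγ_pos : ∀ t ∈ Set.Icc (0 : ℝ) s, 0 < γ t := fun t ht => by
    rw [hγ t]
    exact intervalIntegral_pos_of_pos (Continuous.intervalIntegrable (by fun_prop) _ _)
      (fun _ => Real.exp_pos _) (by linarith [ht.2])
  have hquot : ∀ t ∈ Set.Icc (0 : ℝ) s, HasDerivAt (fun t => -(u t / γ t))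
      (-((u' t * γ t - u t * -(2 * lam * γ t + 1)) / γ t ^ 2)) t := fun t ht =>
    ((hu_deriv t ht).div (hγ_deriv t) (hγ_pos t ht).ne').neg
  have hu_cont : ContinuousOn u (Set.Icc 0 s) := fun t ht =>
    (hu_deriv t ht).continuousAt.continuousWithinAt
  have hγ_cont : ContinuousOn γ (Set.Icc 0 s) := fun t _ =>
    (hγ_deriv t).continuousAt.continuousWithinAt
  have hint : IntegrableOn (fun t => u t / γ t ^ 2) (Set.Icc 0 s) :=
    (hu_cont.div (hγ_cont.pow 2) fun t ht => (pow_pos (hγ_pos t ht) 2).ne').integrableOn_Icc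
  have key := integral_le_sub_of_hasDeriv_right_of_le hs0.le
    (fun t ht => (hquot t ht).continuousAt.continuousWithinAt)
    (fun t ht => (hquot t (Set.Ioo_subset_Icc_self ht)).hasDerivWithinAt) hint
    (fun t ht => by
      have ht' := Set.Ioo_subset_Icc_self ht
      have hpos := hγ_pos t ht'
      have hmul := mul_le_mul_of_nonneg_right (hu_ineq t ht') hpos.le
      rw [sub_mul, div_mul_cancel₀ _ hpos.ne'] at hmul
      rw [← neg_div]
      gcongr
      linarith)
  linarith
end
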